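/- For every e ≥ 3 there exists ε > 0 and C > 0 such that every 3-uniform hypergraph on n vertices with more than C·n^{2−ε} edges contains at most e + ⌊log₂ e⌋ + 38 vertices spanning at least e edges. -/

import Mathlib

/-- A 3-uniform hypergraph on vertex type `V`: a finite set of edges, each of size 3. -/
structure Hypergraph3 (V : Type*) where
  edges : Finset (Finset V)
  card3 : ∀ e ∈ edges, e.card = 3

variable {V : Type*} [DecidableEq V]

/-- The edges of `F` contained in the vertex set `U`. -/
def edgesIn (F : Hypergraph3 V) (U : Finset V) : Finset (Finset V) :=
  F.edges.filter (fun e => e ⊆ U)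

/-- The deficiency `Δ(U) = |U| - e(F[U])`. -/
def defic (F : Hypergraph3 V) (U : Finset V) : ℤ :=
  (U.card : ℤ) - ((edgesIn F U).card : ℤ)

/-- `A` is independent in `F` if no edge of `F` is contained in `A`. -/
def Indep (F : Hypergraph3 V) (A : Finset V) : Prop :=
  ∀ e ∈ F.edges, ¬ e ⊆ A

/-- `A` is good: independent, and every strict superset `U` has `Δ(U) ≥ |A| + 1`. -/
def Good (F : Hypergraph3 V) (A : Finset V) : Prop :=
  Indep F A ∧ ∀ U : Finset V, A ⊂ U → (A.card : ℤ) + 1 ≤ defic F U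

/-- `U` spans `F` if every vertex set that contains `U` and that contains each edge of which it
contains two vertices is the whole vertex set. -/
def Spans {ι : Type} [DecidableEq ι] (F : Hypergraph3 ι) (U : Finset ι) : Prop :=
  ∀ X : Finset ι, U ⊆ X → (∀ f ∈ F.edges, ∀ z ∈ f, f.erase z ⊆ X → z ∈ X) → ∀ i, i ∈ X

/-- Every set of at most `e + b` vertices contains fewer than `e` edges. -/
def LocallySparse {W : Type} [DecidableEq W] (H : Hypergraph3 W) (e b : ℕ) : Prop :=
  ∀ S : Finset W, S.card ≤ e + b → (edgesIn H S).card < e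

/-- The injective homomorphisms from `F` to `H`. -/
def embeddings {ι W : Type} [DecidableEq ι] [Fintype ι] [DecidableEq W] [Fintype W]
    (F : Hypergraph3 ι) (H : Hypergraph3 W) : Finset (ι → W) :=
  {φ | Function.Injective φ ∧ ∀ f ∈ F.edges, f.image φ ∈ H.edges}

/-- `F` has deficiency at most `k + 1` and two disjoint good `k`-sets `A`, `D`, each of which
becomes spanning when `x` is added. -/
structure IsGadget {ι : Type} [DecidableEq ι] [Fintype ι] (F : Hypergraph3 ι)
    (A D : Finset ι) (x y : ι) (k : ℕ) : Prop where
  good_left : Good F A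
  good_right : Good F D
  disj : Disjoint A D
  x_notMem_left : x ∉ A
  x_notMem_right : x ∉ D
  y_mem : y ∈ A
  card_left : A.card = k
  card_right : D.card = k
  spans_left : Spans F (insert x A)
  spans_right : Spans F (insert x D)
  spans_right' : Spans F (insert y D)
  card_le : Fintype.card ι ≤ F.edges.card + k + 1
  two_le_defic : ∀ U : Finset ι, 2 ≤ U.card → 2 ≤ defic F U

/-- `G` consists of two copies of `F`, embedded by `g` and `h`, that share exactly `A`. -/
structure IsGluing {ι κ : Type} [DecidableEq ι] [DecidableEq κ] (F : Hypergraph3 ι) (A : Finset ι)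
    (G : Hypergraph3 κ) (g h : ι → κ) : Prop where
  inj_left : Function.Injective g
  inj_right : Function.Injective h
  agree : ∀ a ∈ A, g a = h a
  sep : ∀ a b, g a = h b → a ∈ A ∧ a = b
  cover : ∀ z, (∃ a, g a = z) ∨ ∃ a, h a = z
  edges_eq : G.edges = F.edges.image (Finset.image g) ∪ F.edges.image (Finset.image h)

section Deficiency

theorem Indep.mono {ι : Type} {F : Hypergraph3 ι} {A U : Finset ι}
    (hA : Indep F A) (hU : U ⊆ A) : Indep F U :=
  fun f hf hfU => hA f hf (hfU.trans hU)

variable {ι : Type} [DecidableEq ι] {F : Hypergraph3 ι} {A U : Finset ι}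

theorem Indep.defic_eq (hA : Indep F A) : defic F A = A.card := by
  have : edgesIn F A = ∅ := by
    apply Finset.filter_eq_empty_iff.2
    exact hA
  simp [defic, this]

theorem edgesIn_mono {S T : Finset ι} (h : S ⊆ T) : edgesIn F S ⊆ edgesIn F T := by
  intro f hf
  simp only [edgesIn, Finset.mem_filter] at hf ⊢
  exact ⟨hf.1, hf.2.trans h⟩

theorem defic_union_le (U T : Finset ι) : defic F (U ∪ T) ≤ defic F U + (T \ U).card := by
  have h1 : (U ∪ T).card = U.card + (T \ U).card := by
    rw [← Finset.union_sdiff_self_eq_union, Finset.card_union_of_disjoint Finset.disjoint_sdiff]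
  have h2 := Finset.card_le_card
    (edgesIn_mono (F := F) (Finset.subset_union_left (s₁ := U) (s₂ := T)))
  simp only [defic, h1]
  push_cast
  omega

/-- Subsets of good sets are good. -/
theorem Good.mono (hA : Good F A) {T : Finset ι} (hT : T ⊆ A) : Good F T := by
  refine ⟨hA.1.mono hT, fun U hTU => ?_⟩
  by_cases hUA : U ⊆ A
  · rw [(hA.1.mono hUA).defic_eq]
    exact_mod_cast Finset.card_lt_card hTU
  · have h1 : A ⊂ U ∪ A := by
      refine Finset.ssubset_iff_subset_ne.2 ⟨Finset.subset_union_right, fun h => hUA ?_⟩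
      rw [h]
      exact Finset.subset_union_left
    have h2 := hA.2 _ h1
    have h3 := defic_union_le (F := F) U A
    have h4 : (A \ U).card ≤ (A \ T).card :=
      Finset.card_le_card (Finset.sdiff_subset_sdiff le_rfl hTU.1)
    have h5 := Finset.card_sdiff_add_card_eq_card hT
    omega

theorem Good.card_le_defic (hA : Good F A) (h : A ⊆ U) : (A.card : ℤ) ≤ defic F U := by
  rcases h.eq_or_ssubset with rfl | h
  · rw [hA.1.defic_eq]
  · linarith [hA.2 U h]

end Deficiency

/-- The trace of `U` on the copy of the vertex set embedded by `g`. -/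
def trace {ι κ : Type} [Fintype ι] [DecidableEq κ] (g : ι → κ) (U : Finset κ) : Finset ι :=
  {i | g i ∈ U}

@[simp] theorem mem_trace {ι κ : Type} [Fintype ι] [DecidableEq κ] {g : ι → κ}
    {U : Finset κ} {i : ι} : i ∈ trace g U ↔ g i ∈ U := by
  simp [trace]

section Gluing

variable {ι κ : Type} [DecidableEq ι] [DecidableEq κ] {F : Hypergraph3 ι}
  {A D : Finset ι} {x y : ι} {k : ℕ} {G : Hypergraph3 κ} {g h : ι → κ}

theorem IsGluing.symm (hG : IsGluing F A G g h) : IsGluing F A G h g where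
  inj_left := hG.inj_right
  inj_right := hG.inj_left
  agree a ha := (hG.agree a ha).symm
  sep a b hab := by
    obtain ⟨h1, rfl⟩ := hG.sep b a hab.symm
    exact ⟨h1, rfl⟩
  cover z := (hG.cover z).symm
  edges_eq := by rw [hG.edges_eq, Finset.union_comm]

theorem IsGluing.card_edges (hG : IsGluing F A G g h) (hF : Indep F A) :
    G.edges.card = 2 * F.edges.card := by
  have hd : Disjoint (F.edges.image (Finset.image g)) (F.edges.image (Finset.image h)) := by
    rw [Finset.disjoint_left]
    intro f h1 h2
    obtain ⟨f', hf', rfl⟩ := Finset.mem_image.1 h1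
    obtain ⟨f'', hf'', he⟩ := Finset.mem_image.1 h2
    refine hF f' hf' fun i hi => ?_
    have : g i ∈ f''.image h := by
      rw [he]
      exact Finset.mem_image_of_mem g hi
    obtain ⟨b, _, hb⟩ := Finset.mem_image.1 this
    exact (hG.sep i b hb.symm).1
  rw [hG.edges_eq, Finset.card_union_of_disjoint hd,
    Finset.card_image_of_injective _ (Finset.image_injective hG.inj_left),
    Finset.card_image_of_injective _ (Finset.image_injective hG.inj_right)]
  omega

variable [Fintype ι]

theorem IsGluing.trace_inter (hG : IsGluing F A G g h) (U : Finset κ) :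
    trace h U ∩ A = trace g U ∩ A := by
  ext i
  simp only [Finset.mem_inter, mem_trace]
  constructor
  · rintro ⟨h1, h2⟩
    exact ⟨by rwa [hG.agree i h2], h2⟩
  · rintro ⟨h1, h2⟩
    exact ⟨by rwa [← hG.agree i h2], h2⟩

theorem IsGluing.card_eq (hG : IsGluing F A G g h) (U : Finset κ) :
    U.card + (trace g U ∩ A).card = (trace g U).card + (trace h U).card := by
  have h1 : U = (trace g U).image g ∪ (trace h U).image h := by
    ext z
    simp only [Finset.mem_union, Finset.mem_image, mem_trace]
    constructor
    · intro hz
      rcases hG.cover z with ⟨a, rfl⟩ | ⟨a, rfl⟩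
      · exact Or.inl ⟨a, hz, rfl⟩
      · exact Or.inr ⟨a, hz, rfl⟩
    · rintro (⟨a, ha, rfl⟩ | ⟨a, ha, rfl⟩) <;> exact ha
  have h2 : (trace g U).image g ∩ (trace h U).image h = (trace g U ∩ A).image g := by
    ext z
    simp only [Finset.mem_inter, Finset.mem_image, mem_trace]
    constructor
    · rintro ⟨⟨a, ha, rfl⟩, b, hb, hab⟩
      exact ⟨a, ⟨ha, (hG.sep a b hab.symm).1⟩, rfl⟩
    · rintro ⟨a, ⟨ha, haA⟩, rfl⟩
      exact ⟨⟨a, ha, rfl⟩, a, by rwa [← hG.agree a haA], (hG.agree a haA).symm⟩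
  have h3 := Finset.card_union_add_card_inter ((trace g U).image g) ((trace h U).image h)
  rw [h2, ← h1, Finset.card_image_of_injective _ hG.inj_left,
    Finset.card_image_of_injective _ hG.inj_left,
    Finset.card_image_of_injective _ hG.inj_right] at h3
  exact h3

theorem IsGluing.card_edgesIn_le (hG : IsGluing F A G g h) (U : Finset κ) :
    (edgesIn G U).card ≤ (edgesIn F (trace g U)).card + (edgesIn F (trace h U)).card := by
  have h1 : edgesIn G U ⊆ (edgesIn F (trace g U)).image (Finset.image g) ∪
      (edgesIn F (trace h U)).image (Finset.image h) := by
    intro f hf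
    simp only [edgesIn, Finset.mem_filter, hG.edges_eq, Finset.mem_union, Finset.mem_image] at hf ⊢
    obtain ⟨⟨f', h1, rfl⟩ | ⟨f', h1, rfl⟩, h2⟩ := hf
    · exact Or.inl ⟨f', ⟨h1, fun i hi => mem_trace.2 (h2 (Finset.mem_image_of_mem g hi))⟩, rfl⟩
    · exact Or.inr ⟨f', ⟨h1, fun i hi => mem_trace.2 (h2 (Finset.mem_image_of_mem h hi))⟩, rfl⟩
  calc (edgesIn G U).card ≤ _ := Finset.card_le_card h1
    _ ≤ _ := Finset.card_union_le _ _
    _ ≤ _ := add_le_add Finset.card_image_le Finset.card_image_le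

theorem IsGluing.defic_ge (hG : IsGluing F A G g h) (U : Finset κ) :
    defic F (trace g U) + defic F (trace h U) - (trace g U ∩ A).card ≤ defic G U := by
  have h1 := hG.card_eq U
  have h2 := hG.card_edgesIn_le U
  simp only [defic]
  omega

theorem IsGluing.two_le_defic (hG : IsGluing F A G g h) (hF : IsGadget F A D x y k)
    (U : Finset κ) (hU : 2 ≤ U.card) : 2 ≤ defic G U := by
  have h1 := hG.defic_ge U
  have h2 := hG.card_eq U
  have h3 := hG.trace_inter U
  have key : ∀ T : Finset ι, 1 ≤ T.card → 1 ≤ defic F T := by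
    intro T hT
    simpa using (hF.good_left.mono (Finset.empty_subset A)).2 T
      (Finset.empty_ssubset.2 (Finset.card_pos.1 hT))
  have hle : ∀ T : Finset ι, T ⊆ A → defic F T = T.card :=
    fun T hT => (hF.good_left.1.mono hT).defic_eq
  have key2 : ∀ T : Finset ι, ¬ T ⊆ A → ((T ∩ A).card : ℤ) + 1 ≤ defic F T := fun T hT =>
    (hF.good_left.mono Finset.inter_subset_right).2 T
      ⟨Finset.inter_subset_left, fun h => hT (h.trans Finset.inter_subset_right)⟩
  by_cases ha : trace g U ⊆ A
  · have e1 := hle _ ha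
    rw [Finset.inter_eq_left.2 ha] at h1 h2
    have := hF.two_le_defic (trace h U) (by omega)
    omega
  by_cases hb : trace h U ⊆ A
  · have e1 := hle _ hb
    rw [← h3, Finset.inter_eq_left.2 hb] at h1 h2
    have := hF.two_le_defic (trace g U) (by omega)
    omega
  have e1 := key2 _ ha
  have e2 := key2 _ hb
  rw [h3] at e2
  omega

theorem IsGluing.good (hG : IsGluing F A G g h) (hF : IsGadget F A D x y k) :
    Good G (insert (g x) (D.image h)) := by
  have hxD : g x ∉ D.image h := by
    simp only [Finset.mem_image, not_exists, not_and]
    intro a _ hax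
    exact hF.x_notMem_left (hG.sep x a hax.symm).1
  constructor
  · intro f hf hsub
    rw [hG.edges_eq, Finset.mem_union, Finset.mem_image, Finset.mem_image] at hf
    rcases hf with ⟨f', hf', rfl⟩ | ⟨f', hf', rfl⟩
    · have h1 : f' ⊆ {x} := by
        intro i hi
        rcases Finset.mem_insert.1 (hsub (Finset.mem_image_of_mem g hi)) with h2 | h2
        · exact Finset.mem_singleton.2 (hG.inj_left h2)
        · obtain ⟨b, hb, hbi⟩ := Finset.mem_image.1 h2
          obtain ⟨h3, rfl⟩ := hG.sep i b hbi.symm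
          exact absurd hb (Finset.disjoint_left.1 hF.disj h3)
      have := Finset.card_le_card h1
      rw [F.card3 f' hf', Finset.card_singleton] at this
      omega
    · refine hF.good_right.1 f' hf' fun i hi => ?_
      rcases Finset.mem_insert.1 (hsub (Finset.mem_image_of_mem h hi)) with h2 | h2
      · exact absurd (hG.sep x i h2.symm).1 hF.x_notMem_left
      · obtain ⟨b, hb, hbi⟩ := Finset.mem_image.1 h2
        rwa [← hG.inj_right hbi]
  · intro U hU
    rw [Finset.card_insert_of_notMem hxD, Finset.card_image_of_injective _ hG.inj_right,
      hF.card_right]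
    have h1 := hG.defic_ge U
    have h2 := hG.card_eq U
    have h3 := hG.trace_inter U
    have hx : x ∈ trace g U := mem_trace.2 (hU.1 (Finset.mem_insert_self _ _))
    have hD : D ⊆ trace h U := fun i hi =>
      mem_trace.2 (hU.1 (Finset.mem_insert_of_mem (Finset.mem_image_of_mem h hi)))
    have hcard := Finset.card_lt_card hU
    rw [Finset.card_insert_of_notMem hxD, Finset.card_image_of_injective _ hG.inj_right,
      hF.card_right] at hcard
    have hg : trace g U ∩ A ⊂ trace g U :=
      ⟨Finset.inter_subset_left, fun h => hF.x_notMem_left (Finset.mem_inter.1 (h hx)).2⟩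
    have d1 := (hF.good_left.mono (Finset.inter_subset_right (s₁ := trace g U))).2 _ hg
    rcases hD.eq_or_ssubset with hDe | hDs
    · have hT : trace g U ∩ A = ∅ := by
        rw [← h3, ← hDe, Finset.inter_comm]
        exact Finset.disjoint_iff_inter_eq_empty.1 hF.disj
      rw [hT, Finset.card_empty, ← hDe, hF.good_right.1.defic_eq, hF.card_right] at h1
      rw [hT, Finset.card_empty, ← hDe, hF.card_right] at h2
      have := hF.two_le_defic (trace g U) (by omega)
      push_cast at *
      omega
    · have d2 := hF.good_right.2 _ hDs
      rw [hF.card_right] at d2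
      push_cast at *
      omega

/-- A set that spans the copy embedded by `h` and contains one further vertex spanning the other
copy together with `A` spans the gluing. -/
theorem IsGluing.spans (hG : IsGluing F A G g h) (hA : Spans F (insert x A))
    {T : Finset ι} (hT : Spans F T) {U : Finset κ} (hxU : g x ∈ U) (hTU : T.image h ⊆ U) :
    Spans G U := by
  intro X hUX hX
  have closed_right : ∀ f ∈ F.edges, ∀ z ∈ f, f.erase z ⊆ trace h X → z ∈ trace h X := by
    intro f hf z hz hfz
    refine mem_trace.2 (hX (f.image h) ?_ (h z) (Finset.mem_image_of_mem h hz) ?_)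
    · rw [hG.edges_eq]
      exact Finset.mem_union_right _ (Finset.mem_image_of_mem _ hf)
    · intro w hw
      obtain ⟨hw1, hw2⟩ := Finset.mem_erase.1 hw
      obtain ⟨i, hi, rfl⟩ := Finset.mem_image.1 hw2
      exact mem_trace.1 (hfz (Finset.mem_erase.2 ⟨fun h => hw1 (by rw [h]), hi⟩))
  have closed_left : ∀ f ∈ F.edges, ∀ z ∈ f, f.erase z ⊆ trace g X → z ∈ trace g X := by
    intro f hf z hz hfz
    refine mem_trace.2 (hX (f.image g) ?_ (g z) (Finset.mem_image_of_mem g hz) ?_)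
    · rw [hG.edges_eq]
      exact Finset.mem_union_left _ (Finset.mem_image_of_mem _ hf)
    · intro w hw
      obtain ⟨hw1, hw2⟩ := Finset.mem_erase.1 hw
      obtain ⟨i, hi, rfl⟩ := Finset.mem_image.1 hw2
      exact mem_trace.1 (hfz (Finset.mem_erase.2 ⟨fun h => hw1 (by rw [h]), hi⟩))
  have all_right := hT (trace h X)
    (fun i hi => mem_trace.2 (hUX (hTU (Finset.mem_image_of_mem h hi)))) closed_right
  have all_left := hA (trace g X) (by
    intro i hi
    rcases Finset.mem_insert.1 hi with rfl | hi
    · exact mem_trace.2 (hUX hxU)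
    · rw [mem_trace, hG.agree i hi]
      exact mem_trace.1 (all_right i)) closed_left
  intro z
  rcases hG.cover z with ⟨a, rfl⟩ | ⟨a, rfl⟩
  · exact mem_trace.1 (all_left a)
  · exact mem_trace.1 (all_right a)

/-- Gluing two copies of a gadget along one of its good sets yields a gadget. -/
theorem IsGluing.isGadget [Fintype κ] (hG : IsGluing F A G g h) (hF : IsGadget F A D x y k) :
    IsGadget G (insert (g x) (D.image h)) (insert (h x) (D.image g)) (g y) (g x) (k + 1) := by
  have hgy : g y = h y := hG.agree y hF.y_mem
  have hxD : g x ∉ D.image h := by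
    simp only [Finset.mem_image, not_exists, not_and]
    intro a _ hax
    exact hF.x_notMem_left (hG.sep x a hax.symm).1
  have hxD' : h x ∉ D.image g := by
    simp only [Finset.mem_image, not_exists, not_and]
    intro a _ hax
    exact hF.x_notMem_left (hG.symm.sep x a hax.symm).1
  have hyD : y ∉ D := Finset.disjoint_left.1 hF.disj hF.y_mem
  have hyx : y ≠ x := fun hyx => hF.x_notMem_left (hyx ▸ hF.y_mem)
  refine ⟨hG.good hF, hG.symm.good hF, ?_, ?_, ?_, Finset.mem_insert_self _ _, ?_, ?_, ?_, ?_, ?_,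
    ?_, hG.two_le_defic hF⟩
  · rw [Finset.disjoint_left]
    intro z hz hz'
    rcases Finset.mem_insert.1 hz with rfl | hz
    · rcases Finset.mem_insert.1 hz' with h1 | h1
      · exact hF.x_notMem_left (hG.sep _ _ h1).1
      · obtain ⟨b, hb, hbx⟩ := Finset.mem_image.1 h1
        exact hF.x_notMem_right (hG.inj_left hbx ▸ hb)
    · obtain ⟨b, hb, rfl⟩ := Finset.mem_image.1 hz
      rcases Finset.mem_insert.1 hz' with h1 | h1
      · exact hF.x_notMem_right (hG.inj_right h1 ▸ hb)
      · obtain ⟨c, hc, hcb⟩ := Finset.mem_image.1 h1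
        exact Finset.disjoint_left.1 hF.disj (hG.sep _ _ hcb).1 hc
  · rw [Finset.mem_insert, not_or]
    refine ⟨fun h1 => hyx (hG.inj_left h1), fun h1 => ?_⟩
    obtain ⟨b, hb, hby⟩ := Finset.mem_image.1 h1
    rw [hgy] at hby
    exact hyD (hG.inj_right hby ▸ hb)
  · rw [Finset.mem_insert, not_or]
    refine ⟨fun h1 => hyx (hG.inj_right (hgy ▸ h1)), fun h1 => ?_⟩
    obtain ⟨b, hb, hby⟩ := Finset.mem_image.1 h1
    exact hyD (hG.inj_left hby ▸ hb)
  · rw [Finset.card_insert_of_notMem hxD, Finset.card_image_of_injective _ hG.inj_right,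
      hF.card_right]
  · rw [Finset.card_insert_of_notMem hxD', Finset.card_image_of_injective _ hG.inj_left,
      hF.card_right]
  · refine hG.spans hF.spans_left hF.spans_right' (by simp) ?_
    rw [Finset.image_insert, hgy]
    exact Finset.insert_subset_insert _ (Finset.subset_insert _ _)
  · refine hG.symm.spans hF.spans_left hF.spans_right' (by simp) ?_
    rw [Finset.image_insert]
    exact Finset.insert_subset_insert _ (Finset.subset_insert _ _)
  · refine hG.symm.spans hF.spans_left hF.spans_right (by simp) ?_
    rw [Finset.image_insert]
    exact Finset.insert_subset_insert _ (Finset.subset_insert _ _)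
  · have h1 := hG.card_eq Finset.univ
    have h2 := hG.card_edges hF.good_left.1
    have h3 : trace g (Finset.univ : Finset κ) = Finset.univ := by ext; simp
    have h4 : trace h (Finset.univ : Finset κ) = Finset.univ := by ext; simp
    have h5 := hF.card_le
    rw [h3, h4, Finset.univ_inter, hF.card_left, Finset.card_univ, Finset.card_univ] at h1
    omega

end Gluing

section Extensions

variable {ι W : Type} [DecidableEq ι] [Fintype ι] [DecidableEq W] [Fintype W]
  {F : Hypergraph3 ι} {H : Hypergraph3 W} {A D : Finset ι} {x y : ι} {k e b : ℕ}

/-- Embedding a copy of `F` from a spanning set onwards creates an edge with each new vertex. -/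
theorem LocallySparse.add_copy (hH : LocallySparse H e b) {d : ℕ} (hd : d ≤ b) {φ : ι → W}
    (hφ : φ ∈ embeddings F H) {U : Finset ι} (hU : Spans F U) {S : Finset W}
    (hUS : U.image φ ⊆ S) (hS : S.card ≤ (edgesIn H S).card + d) (hSe : (edgesIn H S).card < e) :
    (edgesIn H (S ∪ Finset.univ.image φ)).card < e ∧
      (S ∪ Finset.univ.image φ).card ≤ (edgesIn H (S ∪ Finset.univ.image φ)).card + d := by
  simp only [embeddings, Finset.mem_filter, Finset.mem_univ, true_and] at hφ
  let P : Finset (Finset W) := {T | S ⊆ T ∧ T ⊆ S ∪ Finset.univ.image φ ∧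
    T.card ≤ (edgesIn H T).card + d ∧ (edgesIn H T).card < e}
  have hP : S ∈ P := by simp [P, hS, hSe]
  obtain ⟨T, hTP, hmax⟩ := P.exists_max_image Finset.card ⟨S, hP⟩
  simp only [P, Finset.mem_filter, Finset.mem_univ, true_and] at hTP hmax
  obtain ⟨h1, h2, h3, h4⟩ := hTP
  have hall := hU (trace φ T)
    (fun i hi => mem_trace.2 (h1 (hUS (Finset.mem_image_of_mem φ hi)))) (by
    intro f hf z hz hfz
    by_contra hzT
    rw [mem_trace] at hzT
    have hnew : f.image φ ⊆ insert (φ z) T := by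
      intro w hw
      obtain ⟨i, hi, rfl⟩ := Finset.mem_image.1 hw
      by_cases hiz : i = z
      · exact hiz ▸ Finset.mem_insert_self _ _
      · exact Finset.mem_insert_of_mem (mem_trace.1 (hfz (Finset.mem_erase.2 ⟨hiz, hi⟩)))
    have hlt : (edgesIn H T).card < (edgesIn H (insert (φ z) T)).card := by
      refine Finset.card_lt_card ⟨edgesIn_mono (Finset.subset_insert _ _), fun hs => hzT ?_⟩
      have : f.image φ ∈ edgesIn H (insert (φ z) T) := Finset.mem_filter.2 ⟨hφ.2 f hf, hnew⟩
      exact (Finset.mem_filter.1 (hs this)).2 (Finset.mem_image_of_mem φ hz)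
    have hc := Finset.card_insert_of_notMem hzT
    have := hmax (insert (φ z) T) ⟨h1.trans (Finset.subset_insert _ _),
      Finset.insert_subset (Finset.mem_union_right _ (Finset.mem_image_of_mem φ (Finset.mem_univ z)))
        h2, by omega, hH _ (by omega)⟩
    omega)
  have hTeq : T = S ∪ Finset.univ.image φ := by
    refine Finset.Subset.antisymm h2 (Finset.union_subset h1 ?_)
    intro w hw
    obtain ⟨i, _, rfl⟩ := Finset.mem_image.1 hw
    exact mem_trace.1 (hall i)
  rw [← hTeq]
  exact ⟨h4, h3⟩

theorem LocallySparse.copy (hH : LocallySparse H e b) (hF : IsGadget F A D x y k)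
    (hk : k + 2 ≤ b) {φ : ι → W} (hφ : φ ∈ embeddings F H) :
    (edgesIn H (Finset.univ.image φ)).card < e ∧
      (Finset.univ.image φ).card ≤ (edgesIn H (Finset.univ.image φ)).card + (k + 1) := by
  have hinj : Function.Injective φ := (Finset.mem_filter.1 hφ).2.1
  have hc : ((insert x A).image φ).card = k + 1 := by
    rw [Finset.card_image_of_injective _ hinj, Finset.card_insert_of_notMem hF.x_notMem_left,
      hF.card_left]
  have := hH.add_copy (d := k + 1) (by omega) hφ hF.spans_left (le_refl ((insert x A).image φ))
    (by omega) (hH _ (by omega))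
  rwa [Finset.union_eq_right.2 (Finset.image_subset_image (Finset.subset_univ _))] at this

/-- A petal attached to a set `S` along a strict superset of `A` contains at least as many new
edges as new vertices. -/
theorem LocallySparse.add_petal (hH : LocallySparse H e b) (hF : IsGadget F A D x y k)
    (hk : k + 2 ≤ b) {U : Finset ι} (hU : A ⊂ U) {φ : ι → W} (hφ : φ ∈ embeddings F H)
    {S : Finset W} (hUS : U.image φ ⊆ S) (hdisj : ∀ i ∉ U, φ i ∉ S)
    (hS : S.card ≤ (edgesIn H S).card + (k + 1)) (hSe : (edgesIn H S).card < e) :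
    (edgesIn H (S ∪ Finset.univ.image φ)).card < e ∧
      (S ∪ Finset.univ.image φ).card ≤ (edgesIn H (S ∪ Finset.univ.image φ)).card + (k + 1) := by
  have hφ' := (Finset.mem_filter.1 hφ).2
  constructor
  · have hx := Finset.card_insert_le (φ x) S
    have hmono := Finset.card_le_card (edgesIn_mono (F := H) (Finset.subset_insert (φ x) S))
    have h1 := hH.add_copy (d := k + 2) hk hφ hF.spans_left (S := insert (φ x) S) (by
      rw [Finset.image_insert]
      exact Finset.insert_subset_insert _ ((Finset.image_subset_image hU.1).trans hUS))
      (by omega) (hH _ (by omega))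
    rw [Finset.insert_union, Finset.insert_eq_of_mem (Finset.mem_union_right _
      (Finset.mem_image_of_mem φ (Finset.mem_univ x)))] at h1
    exact h1.1
  · have hcard : (S ∪ Finset.univ.image φ).card = S.card + Uᶜ.card := by
      have : S ∪ Finset.univ.image φ = S ∪ Uᶜ.image φ := by
        rw [← Finset.union_compl U, Finset.image_union, ← Finset.union_assoc,
          Finset.union_eq_left.2 hUS]
      rw [this, Finset.card_union_of_disjoint, Finset.card_image_of_injective _ hφ'.1]
      rw [Finset.disjoint_right]
      intro w hw
      obtain ⟨i, hi, rfl⟩ := Finset.mem_image.1 hw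
      exact hdisj i (Finset.mem_compl.1 hi)
    have hedges : (edgesIn H S).card + (F.edges \ edgesIn F U).card ≤
        (edgesIn H (S ∪ Finset.univ.image φ)).card := by
      rw [← Finset.card_image_of_injective (F.edges \ edgesIn F U)
        (Finset.image_injective hφ'.1), ← Finset.card_union_of_disjoint]
      · refine Finset.card_le_card (Finset.union_subset (edgesIn_mono Finset.subset_union_left) ?_)
        intro f hf
        obtain ⟨f', hf', rfl⟩ := Finset.mem_image.1 hf
        exact Finset.mem_filter.2 ⟨hφ'.2 _ (Finset.mem_sdiff.1 hf').1,
          (Finset.image_subset_image (Finset.subset_univ _)).trans Finset.subset_union_right⟩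
      · rw [Finset.disjoint_right]
        intro f hf hfS
        obtain ⟨f', hf', rfl⟩ := Finset.mem_image.1 hf
        obtain ⟨h1, h2⟩ := Finset.mem_sdiff.1 hf'
        refine h2 (Finset.mem_filter.2 ⟨h1, fun i hi => ?_⟩)
        by_contra hiU
        exact hdisj i hiU ((Finset.mem_filter.1 hfS).2 (Finset.mem_image_of_mem φ hi))
    have hsd := Finset.card_sdiff_add_card_eq_card (Finset.filter_subset (fun f => f ⊆ U) F.edges)
    have hdef := hF.good_left.2 U hU
    have hle := hF.card_le
    have hcompl := Finset.card_add_card_compl U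
    rw [hF.card_left] at hdef
    simp only [defic] at hdef
    change (F.edges \ edgesIn F U).card + (edgesIn F U).card = _ at hsd
    omega

/-- In a locally sparse hypergraph, embeddings with prescribed values on a strict superset of `A`
are bounded in number. -/
theorem LocallySparse.card_extensions_le (hH : LocallySparse H e b) (hF : IsGadget F A D x y k)
    (hk : k + 2 ≤ b) (r : ℕ) : ∀ U : Finset ι, A ⊂ U → Uᶜ.card = r → ∀ ψ : ι → W,
    ((embeddings F H).filter fun φ => ∀ u ∈ U, φ u = ψ u).card ≤
      (Fintype.card ι * (e + k + 1)) ^ r := by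
  induction r with
  | zero =>
    intro U _ hUc ψ
    rw [pow_zero, Finset.card_le_one]
    intro φ hφ φ' hφ'
    have hall : ∀ i, i ∈ U := by
      intro i
      have := Finset.card_eq_zero.1 hUc
      rw [Finset.compl_eq_empty_iff] at this
      simp [this]
    funext i
    rw [(Finset.mem_filter.1 hφ).2 i (hall i), (Finset.mem_filter.1 hφ').2 i (hall i)]
  | succ r ih =>
    intro U hU hUc ψ
    by_contra! hlt
    set E := (embeddings F H).filter fun φ => ∀ u ∈ U, φ u = ψ u with hE
    obtain ⟨φ₀, hφ₀⟩ : E.Nonempty := Finset.card_pos.1 (by omega)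
    let P : Finset (Finset W) := {S | U.image ψ ⊆ S ∧
      S.card ≤ (edgesIn H S).card + (k + 1) ∧ (edgesIn H S).card < e}
    have himage : ∀ φ ∈ E, U.image φ = U.image ψ := fun φ hφ =>
      Finset.image_congr fun u hu => (Finset.mem_filter.1 hφ).2 u hu
    have hP : Finset.univ.image φ₀ ∈ P := by
      have h1 := hH.copy hF hk (Finset.mem_filter.1 hφ₀).1
      refine Finset.mem_filter.2 ⟨Finset.mem_univ _, ?_, h1.2, h1.1⟩
      rw [← himage φ₀ hφ₀]
      exact Finset.image_subset_image (Finset.subset_univ _)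
    obtain ⟨S, hSP, hmax⟩ := P.exists_max_image Finset.card ⟨_, hP⟩
    simp only [P, Finset.mem_filter, Finset.mem_univ, true_and] at hSP hmax
    obtain ⟨h1, h2, h3⟩ := hSP
    obtain ⟨φ, hφE, hφS⟩ : ∃ φ ∈ E, ∀ i ∉ U, φ i ∉ S := by
      by_contra! hcon
      have hsub : E ⊆ (Uᶜ ×ˢ S).biUnion fun p => (embeddings F H).filter fun φ =>
          ∀ u ∈ insert p.1 U, φ u = Function.update ψ p.1 p.2 u := by
        intro φ hφ
        obtain ⟨i, hiU, hiS⟩ := hcon φ hφ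
        refine Finset.mem_biUnion.2 ⟨(i, φ i), Finset.mem_product.2
          ⟨Finset.mem_compl.2 hiU, hiS⟩, Finset.mem_filter.2 ⟨(Finset.mem_filter.1 hφ).1, ?_⟩⟩
        intro u hu
        rcases Finset.mem_insert.1 hu with rfl | hu
        · simp
        · have hne : u ≠ i := fun h => hiU (h ▸ hu)
          simp only [Function.update_of_ne hne]
          exact (Finset.mem_filter.1 hφ).2 u hu
      have hcard := (Finset.card_le_card hsub).trans (Finset.card_biUnion_le_card_mul _ _
        ((Fintype.card ι * (e + k + 1)) ^ r) (by
          rintro ⟨i, w⟩ hp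
          have hi : i ∉ U := Finset.mem_compl.1 (Finset.mem_product.1 hp).1
          refine ih (insert i U) (hU.trans (Finset.ssubset_insert hi)) ?_ _
          have ha := Finset.card_add_card_compl U
          have hb := Finset.card_add_card_compl (insert i U)
          rw [Finset.card_insert_of_notMem hi] at hb
          omega))
      have hprod : (Uᶜ ×ˢ S).card ≤ Fintype.card ι * (e + k + 1) := by
        rw [Finset.card_product]
        exact Nat.mul_le_mul (Finset.card_le_univ _) (by omega)
      have := hcard.trans (Nat.mul_le_mul_right _ hprod)
      rw [pow_succ'] at hlt
      omega
    have hφemb := (Finset.mem_filter.1 hφE).1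
    have hnew := hH.add_petal hF hk hU hφemb (himage φ hφE ▸ h1) hφS h2 h3
    have hle := hmax _ ⟨h1.trans Finset.subset_union_left, hnew.2, hnew.1⟩
    obtain ⟨i, hi⟩ : (Uᶜ).Nonempty := Finset.card_pos.1 (by omega)
    have hlt' : S.card < (S ∪ Finset.univ.image φ).card := by
      refine Finset.card_lt_card ⟨Finset.subset_union_left, fun hs => ?_⟩
      exact hφS i (Finset.mem_compl.1 hi)
        (hs (Finset.mem_union_right _ (Finset.mem_image_of_mem φ (Finset.mem_univ i))))
    omega

end Extensions

section Doubling

variable {ι : Type} [DecidableEq ι]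

/-- The map embedding the second copy of `ι` into two copies of `ι` glued along `A`. -/
def secondCopy (A : Finset ι) (i : ι) : ι ⊕ {i : ι // i ∉ A} :=
  if hi : i ∈ A then Sum.inl i else Sum.inr ⟨i, hi⟩

theorem secondCopy_injective (A : Finset ι) : Function.Injective (secondCopy A) := by
  intro i j hij
  unfold secondCopy at hij
  split_ifs at hij <;> simpa using hij

/-- Two copies of `F` glued along `A`. -/
def doubling (F : Hypergraph3 ι) (A : Finset ι) : Hypergraph3 (ι ⊕ {i : ι // i ∉ A}) where
  edges := F.edges.image (Finset.image Sum.inl) ∪ F.edges.image (Finset.image (secondCopy A))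
  card3 := by
    intro f hf
    rw [Finset.mem_union, Finset.mem_image, Finset.mem_image] at hf
    rcases hf with ⟨f', hf', rfl⟩ | ⟨f', hf', rfl⟩
    · rw [Finset.card_image_of_injective _ Sum.inl_injective, F.card3 f' hf']
    · rw [Finset.card_image_of_injective _ (secondCopy_injective A), F.card3 f' hf']

theorem isGluing_doubling (F : Hypergraph3 ι) (A : Finset ι) :
    IsGluing F A (doubling F A) Sum.inl (secondCopy A) where
  inj_left := Sum.inl_injective
  inj_right := secondCopy_injective A
  agree a ha := by simp [secondCopy, ha]
  sep a b hab := by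
    unfold secondCopy at hab
    split_ifs at hab with hb
    obtain rfl := Sum.inl_injective hab
    exact ⟨hb, rfl⟩
  cover := by
    rintro (a | ⟨a, ha⟩)
    · exact Or.inl ⟨a, rfl⟩
    · exact Or.inr ⟨a, by simp [secondCopy, ha]⟩
  edges_eq := rfl

variable [Fintype ι] {W : Type} [DecidableEq W] [Fintype W] {F : Hypergraph3 ι}
  {H : Hypergraph3 W} {A D : Finset ι} {x y : ι} {k e b : ℕ}

theorem sq_card_le_card_mul_pairs (Φ : Finset (ι → W)) (A : Finset ι) :
    Φ.card ^ 2 ≤ Fintype.card W ^ A.card *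
      ((Φ ×ˢ Φ).filter fun p => ∀ a ∈ A, p.1 a = p.2 a).card := by
  let ρ : (ι → W) → (A → W) := fun φ a => φ a
  have h1 : Φ.card = ∑ σ : A → W, (Φ.filter fun φ => ρ φ = σ).card :=
    Finset.card_eq_sum_card_fiberwise fun _ _ => Finset.mem_coe.2 (Finset.mem_univ _)
  have h2 : ((Φ ×ˢ Φ).filter fun p => ∀ a ∈ A, p.1 a = p.2 a).card =
      ∑ σ : A → W, (Φ.filter fun φ => ρ φ = σ).card ^ 2 := by
    rw [Finset.card_eq_sum_card_fiberwise (f := fun p : (ι → W) × (ι → W) => ρ p.1)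
      (t := Finset.univ) fun _ _ => Finset.mem_coe.2 (Finset.mem_univ _)]
    refine Finset.sum_congr rfl fun σ _ => ?_
    rw [sq, ← Finset.card_product]
    congr 1
    ext ⟨φ, φ'⟩
    simp only [Finset.mem_filter, Finset.mem_product]
    constructor
    · rintro ⟨⟨⟨ha, hb⟩, hc⟩, rfl⟩
      exact ⟨⟨ha, rfl⟩, hb, funext fun a => (hc a a.2).symm⟩
    · rintro ⟨⟨ha, rfl⟩, hb, hc⟩
      exact ⟨⟨⟨ha, hb⟩, fun a haA => (congrFun hc ⟨a, haA⟩).symm⟩, rfl⟩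
  have h3 := sq_sum_le_card_mul_sum_sq (s := (Finset.univ : Finset (A → W)))
    (f := fun σ => (Φ.filter fun φ => ρ φ = σ).card)
  rw [h2]
  rw [← h1] at h3
  simpa using h3

/-- Pairs of embeddings that agree on `A` and are disjoint elsewhere embed the double of `F`. -/
theorem card_pairs_le (F : Hypergraph3 ι) (H : Hypergraph3 W) (A : Finset ι) :
    ((embeddings F H ×ˢ embeddings F H).filter fun p => (∀ a ∈ A, p.1 a = p.2 a) ∧
      ∀ i, ∀ j ∉ A, p.1 i ≠ p.2 j).card ≤ (embeddings (doubling F A) H).card := by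
  refine Finset.card_le_card_of_injOn (fun p => Sum.elim p.1 fun i => p.2 i) ?_ ?_
  · rintro ⟨φ, φ'⟩ hp
    simp only [Finset.coe_filter, Set.mem_ofPred_eq, Finset.mem_product, embeddings,
      Finset.mem_filter, Finset.mem_univ, true_and] at hp ⊢
    obtain ⟨⟨⟨h1, h2⟩, h3, h4⟩, h5, h6⟩ := hp
    have hcomp : (Sum.elim φ fun i : {i // i ∉ A} => φ' i) ∘ secondCopy A = φ' := by
      funext i
      by_cases hi : i ∈ A
      · simp [secondCopy, hi, h5 i hi]
      · simp [secondCopy, hi]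
    refine ⟨?_, ?_⟩
    · rintro (i | ⟨i, hi⟩) (j | ⟨j, hj⟩) hij
      · exact congrArg _ (h1 hij)
      · exact absurd hij (h6 i j hj)
      · exact absurd hij.symm (h6 j i hi)
      · exact congrArg _ (Subtype.ext (h3 hij))
    · intro f hf
      rcases Finset.mem_union.1 hf with hf | hf
      · obtain ⟨f', hf', rfl⟩ := Finset.mem_image.1 hf
        rw [Finset.image_image, Sum.elim_comp_inl]
        exact h2 f' hf'
      · obtain ⟨f', hf', rfl⟩ := Finset.mem_image.1 hf
        rw [Finset.image_image, hcomp]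
        exact h4 f' hf'
  · rintro ⟨φ, φ'⟩ hp ⟨χ, χ'⟩ hq hpq
    simp only [Finset.coe_filter, Set.mem_ofPred_eq] at hp hq
    have h1 : φ = χ := funext fun i => congrFun hpq (Sum.inl i)
    have h2 : φ' = χ' := by
      funext i
      by_cases hi : i ∈ A
      · rw [← hp.2.1 i hi, ← hq.2.1 i hi, h1]
      · exact congrFun hpq (Sum.inr ⟨i, hi⟩)
    rw [h1, h2]

/-- Few pairs of embeddings that agree on `A` intersect elsewhere. -/
theorem LocallySparse.card_colliding_le (hH : LocallySparse H e b) (hF : IsGadget F A D x y k)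
    (hk : k + 2 ≤ b) :
    ((embeddings F H ×ˢ embeddings F H).filter fun p => (∀ a ∈ A, p.1 a = p.2 a) ∧
      ∃ i, ∃ j ∉ A, p.1 i = p.2 j).card ≤ (embeddings F H).card * Fintype.card ι ^ 2 *
        (Fintype.card ι * (e + k + 1)) ^ (Fintype.card ι - (k + 1)) := by
  have hsub : ((embeddings F H ×ˢ embeddings F H).filter fun p => (∀ a ∈ A, p.1 a = p.2 a) ∧
      ∃ i, ∃ j ∉ A, p.1 i = p.2 j) ⊆
      (embeddings F H ×ˢ ((Finset.univ : Finset ι) ×ˢ Aᶜ)).biUnion fun q =>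
        ((embeddings F H).filter fun φ =>
          ∀ u ∈ insert q.2.2 A, φ u = Function.update q.1 q.2.2 (q.1 q.2.1) u).image
            fun φ => (q.1, φ) := by
    rintro ⟨φ, φ'⟩ hp
    simp only [Finset.mem_filter, Finset.mem_product] at hp
    obtain ⟨⟨h1, h2⟩, h3, i, j, hj, hij⟩ := hp
    refine Finset.mem_biUnion.2 ⟨(φ, i, j), ?_, Finset.mem_image.2 ⟨φ', ?_, rfl⟩⟩
    · simp [h1, hj]
    · refine Finset.mem_filter.2 ⟨h2, fun u hu => ?_⟩
      rcases Finset.mem_insert.1 hu with rfl | hu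
      · simp [hij]
      · have hne : u ≠ j := fun h => hj (h ▸ hu)
        simp only [Function.update_of_ne hne]
        exact (h3 u hu).symm
  have hcard := (Finset.card_le_card hsub).trans (Finset.card_biUnion_le_card_mul _ _
    ((Fintype.card ι * (e + k + 1)) ^ (Fintype.card ι - (k + 1))) (by
      rintro ⟨φ, i, j⟩ hq
      have hj : j ∉ A := by simpa using (Finset.mem_product.1 (Finset.mem_product.1 hq).2).2
      refine Finset.card_image_le.trans
        (hH.card_extensions_le hF hk _ (insert j A) (Finset.ssubset_insert hj) ?_ _)
      rw [Finset.card_compl, Finset.card_insert_of_notMem hj, hF.card_left]))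
  refine hcard.trans (Nat.mul_le_mul_right _ ?_)
  rw [Finset.card_product, Finset.card_product, Finset.card_univ, sq]
  exact Nat.mul_le_mul_left _ (Nat.mul_le_mul_left _ (Finset.card_le_univ _))

theorem LocallySparse.sq_card_embeddings_le (hH : LocallySparse H e b)
    (hF : IsGadget F A D x y k) (hk : k + 2 ≤ b) :
    (embeddings F H).card ^ 2 ≤ Fintype.card W ^ k * ((embeddings (doubling F A) H).card +
      (embeddings F H).card * Fintype.card ι ^ 2 *
        (Fintype.card ι * (e + k + 1)) ^ (Fintype.card ι - (k + 1))) := by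
  have h1 := sq_card_le_card_mul_pairs (embeddings F H) A
  rw [hF.card_left] at h1
  refine h1.trans (Nat.mul_le_mul_left _ ?_)
  refine le_trans ?_ (add_le_add (card_pairs_le F H A) (hH.card_colliding_le hF hk))
  refine le_trans (Finset.card_le_card ?_) (Finset.card_union_le _ _)
  intro p hp
  rw [Finset.mem_union, Finset.mem_filter, Finset.mem_filter]
  obtain ⟨h2, h3⟩ := Finset.mem_filter.1 hp
  by_cases hcol : ∃ i, ∃ j ∉ A, p.1 i = p.2 j
  · exact Or.inr ⟨h2, h3, hcol⟩
  · push Not at hcol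
    exact Or.inl ⟨h2, h3, hcol⟩

end Doubling

section Counting

/-- Locally sparse hypergraphs with more than `C n ^ (2 - ε)` edges contain at least
`c n ^ (j + 2 - 2 ^ j ε)` copies of `F`. -/
def Abundant {ι : Type} [DecidableEq ι] [Fintype ι] (F : Hypergraph3 ι) (e b j : ℕ) : Prop :=
  ∀ c : ℝ, 0 < c → ∃ C : ℝ, 0 < C ∧ ∀ ε : ℝ, 0 < ε → 2 ^ j * ε ≤ 1 →
    ∀ (W : Type) (_ : DecidableEq W) (_ : Fintype W) (H : Hypergraph3 W), LocallySparse H e b →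
      1 ≤ Fintype.card W → C * (Fintype.card W : ℝ) ^ ((2 : ℝ) - ε) < (H.edges.card : ℝ) →
      c * (Fintype.card W : ℝ) ^ ((j : ℝ) + 2 - 2 ^ j * ε) ≤ ((embeddings F H).card : ℝ)

theorem Abundant.succ {ι : Type} [DecidableEq ι] [Fintype ι] {F : Hypergraph3 ι}
    {A D : Finset ι} {x y : ι} {e b j : ℕ} (hF : IsGadget F A D x y (j + 1)) (hj : j + 3 ≤ b)
    (hab : Abundant F e b j) : Abundant (doubling F A) e b (j + 1) := by
  intro c hc
  set K : ℕ := Fintype.card ι ^ 2 *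
    (Fintype.card ι * (e + (j + 1) + 1)) ^ (Fintype.card ι - (j + 1 + 1)) with hK
  obtain ⟨C, hC, hCN⟩ := hab (2 * K + 2 * c + 1) (by positivity)
  refine ⟨C, hC, fun ε hε hε1 W _ _ H hH hn hm => ?_⟩
  have hε2 : 2 ^ j * ε ≤ 1 := by
    have : (0 : ℝ) < 2 ^ j * ε := by positivity
    rw [pow_succ] at hε1
    linarith
  have hN := hCN ε hε hε2 W _ _ H hH hn hm
  have hcs := hH.sq_card_embeddings_le hF (by omega)
  rw [mul_assoc _ (Fintype.card ι ^ 2), ← hK] at hcs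
  have hcs' : ((embeddings F H).card : ℝ) ^ 2 ≤ (Fintype.card W : ℝ) ^ (j + 1) *
      (((embeddings (doubling F A) H).card : ℝ) + (embeddings F H).card * K) := by
    exact_mod_cast hcs
  set N : ℝ := ((embeddings F H).card : ℝ)
  set M : ℝ := ((embeddings (doubling F A) H).card : ℝ)
  set n : ℝ := (Fintype.card W : ℝ)
  have hn1 : 1 ≤ n := Nat.one_le_cast.2 hn
  have hn0 : 0 < n := by linarith
  set q : ℝ := n ^ (1 - 2 ^ j * ε) with hq
  have hq1 : 1 ≤ q := Real.one_le_rpow hn1 (by linarith)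
  have e1 : n ^ ((j : ℝ) + 2 - 2 ^ j * ε) = n ^ (j + 1) * q := by
    rw [hq, ← Real.rpow_natCast n, ← Real.rpow_add hn0]
    congr 1
    push_cast
    ring
  have e2 : n ^ (((j + 1 : ℕ) : ℝ) + 2 - 2 ^ (j + 1) * ε) = n ^ (j + 1) * q ^ 2 := by
    rw [hq, ← Real.rpow_natCast n, ← Real.rpow_mul_natCast hn0.le, ← Real.rpow_add hn0]
    congr 1
    push_cast
    ring
  rw [e1] at hN
  rw [e2]
  set p : ℝ := n ^ (j + 1)
  have hp : 0 < p := by positivity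
  obtain ⟨u, hu⟩ : ∃ u, N = p * u := ⟨N / p, by field_simp⟩
  rw [hu] at hN hcs'
  have hu1 : (2 * K + 2 * c + 1) * q ≤ u := by
    have : p * ((2 * K + 2 * c + 1) * q) ≤ p * u := by linarith
    exact le_of_mul_le_mul_left this hp
  have hM : p * u ^ 2 ≤ M + p * u * K := by
    have : p * (p * u ^ 2) ≤ p * (M + p * u * K) := by linarith
    exact le_of_mul_le_mul_left this hp
  have hK0 : (0 : ℝ) ≤ K := by positivity
  have hu2 : c * q ^ 2 ≤ u * (u - K) := by
    have a1 : q ≤ u := by nlinarith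
    have a2 : c * q ≤ u - K := by nlinarith
    have a3 : 0 ≤ c * q := by positivity
    nlinarith
  nlinarith

/-- The hypergraph with three vertices and one edge. -/
def singleEdge : Hypergraph3 (Fin 3) := ⟨{Finset.univ}, by simp⟩

theorem isGadget_singleEdge : IsGadget singleEdge {0} {1} 2 0 1 := by
  constructor
  · unfold Good Indep
    decide
  · unfold Good Indep
    decide
  all_goals first
    | decide
    | (unfold Spans; decide)

theorem abundant_singleEdge (e b : ℕ) : Abundant singleEdge e b 0 := by
  intro c hc
  refine ⟨c, hc, fun ε _ _ W _ _ H _ _ hm => ?_⟩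
  have hle : H.edges.card ≤ (embeddings singleEdge H).card := by
    refine Finset.card_le_card_of_surjOn (fun φ => Finset.univ.image φ) fun f hf => ?_
    obtain ⟨u, v, w, huv, huw, hvw, rfl⟩ := Finset.card_eq_three.1 (H.card3 f hf)
    have himage : Finset.univ.image ![u, v, w] = {u, v, w} := by
      ext z
      simp [Fin.exists_fin_succ, eq_comm]
    refine ⟨![u, v, w], ?_, himage⟩
    simp only [embeddings, singleEdge, Finset.mem_singleton, forall_eq, himage,
      Finset.coe_filter, Set.mem_ofPred_eq, Finset.mem_univ, true_and]
    refine ⟨?_, hf⟩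
    intro i j hij
    fin_cases i <;> fin_cases j <;> simp_all
  have hle' : (H.edges.card : ℝ) ≤ (embeddings singleEdge H).card := by exact_mod_cast hle
  have : ((0 : ℕ) : ℝ) + 2 - 2 ^ 0 * ε = 2 - ε := by
    push_cast
    ring
  rw [this]
  linarith

theorem exists_abundant_gadget (e b j : ℕ) (hj : j + 2 ≤ b) :
    ∃ (ι : Type) (_ : DecidableEq ι) (_ : Fintype ι) (F : Hypergraph3 ι) (A D : Finset ι)
      (x y : ι), IsGadget F A D x y (j + 1) ∧ F.edges.card = 2 ^ j ∧ Abundant F e b j := by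
  induction j with
  | zero => exact ⟨Fin 3, _, _, singleEdge, _, _, _, _, isGadget_singleEdge, rfl,
      abundant_singleEdge e b⟩
  | succ j ih =>
    obtain ⟨ι, _, _, F, A, D, x, y, hF, hcard, hab⟩ := ih (by omega)
    have hG := isGluing_doubling F A
    refine ⟨_, inferInstance, inferInstance, doubling F A, _, _, _, _, hG.isGadget hF, ?_,
      hab.succ hF (by omega)⟩
    rw [hG.card_edges hF.good_left.1, hcard, pow_succ']

end Counting

/-- main theorem: for every `e ≥ 3` there exist `ε > 0` and `C > 0` such that
every 3-uniform hypergraph on `n` vertices with more than `C · n^(2-ε)` edges contains at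
most `e + ⌊log₂ e⌋ + 38` vertices spanning at least `e` edges. -/
theorem power_saving_BES (e : ℕ) (he : 3 ≤ e) :
    ∃ ε : ℝ, 0 < ε ∧ ∃ C : ℝ, 0 < C ∧
      ∀ (W : Type) (_ : DecidableEq W) (_ : Fintype W) (H : Hypergraph3 W),
        C * (Fintype.card W : ℝ) ^ ((2 : ℝ) - ε) < (H.edges.card : ℝ) →
        ∃ S : Finset W, S.card ≤ e + Nat.log 2 e + 38 ∧ e ≤ (edgesIn H S).card := by
  set L := Nat.log 2 e
  obtain ⟨ι, _, _, F, A, D, x, y, hF, hcard, hab⟩ :=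
    exists_abundant_gadget e (L + 38) (L + 1) (by omega)
  obtain ⟨C, hC, hmain⟩ := hab 1 one_pos
  refine ⟨((2 : ℝ) ^ (L + 1))⁻¹, by positivity, C, hC, fun W _ _ H hm => ?_⟩
  by_contra! hcon
  have hH : LocallySparse H e (L + 38) := fun S hS => hcon S (by omega)
  have hn : 1 ≤ Fintype.card W := by
    have hpos : (0 : ℝ) < H.edges.card := lt_of_le_of_lt (by positivity) hm
    obtain ⟨f, hf⟩ := Finset.card_pos.1 (Nat.cast_pos.1 hpos)
    have := (H.card3 f hf).symm.trans_le (Finset.card_le_univ f)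
    omega
  have hN := hmain _ (by positivity) (mul_inv_cancel₀ (by positivity)).le W _ _ H hH hn hm
  have hNpos : (0 : ℝ) < (embeddings F H).card := by
    refine lt_of_lt_of_le ?_ hN
    have : (0 : ℝ) < Fintype.card W := by exact_mod_cast hn
    positivity
  obtain ⟨φ, hφ⟩ := Finset.card_pos.1 (Nat.cast_pos.1 hNpos)
  have hlt := (hH.copy hF (by omega) hφ).1
  have hφ' := (Finset.mem_filter.1 hφ).2
  have hge : F.edges.card ≤ (edgesIn H (Finset.univ.image φ)).card := by
    rw [← Finset.card_image_of_injective F.edges (Finset.image_injective hφ'.1)]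
    refine Finset.card_le_card fun f hf => ?_
    obtain ⟨f', hf', rfl⟩ := Finset.mem_image.1 hf
    exact Finset.mem_filter.2 ⟨hφ'.2 f' hf', Finset.image_subset_image (Finset.subset_univ _)⟩
  have hlog : e < 2 ^ (L + 1) := Nat.lt_pow_succ_log_self (by norm_num) e
  omega
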